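/- Let G and H be rooted trees in each of which every internal vertex has at least two children, with leaf enumerations a_1, …, a_k of G and b_1, …, b_k of H. Then there exists a graph isomorphism f from G to H mapping the root of G to the root of H with f(a_i) = b_i for all i, if and only if the LCAG matrices of G and H under these enumerations are equal. In other words, the LCAG matrix is a complete invariant of such rooted trees up to rooted-tree isomorphism respecting the leaf enumeration. -/

import Mathlib

open scoped Classical

/-- A rooted tree: a finite tree (connected acyclic simple graph) together with a
distinguished vertex called the root. -/
structure RTree (V : Type*) [Fintype V] where
  G : SimpleGraph V
  isTree : G.IsTree
  root : V

namespace RTree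

variable {V : Type*} [Fintype V]

/-- `u` is an ancestor of `v`: `u` lies on the unique path from `v` to the root
(equivalently, the distances satisfy `dist root v = dist root u + dist u v`).
Every vertex is an ancestor of itself. -/
def Ancestor (T : RTree V) (u v : V) : Prop :=
  T.G.dist T.root v = T.G.dist T.root u + T.G.dist u v

/-- `v` is a child of `u`: `u` is the ancestor of `v` at graph distance `1`
(i.e. `u` is the parent of `v`). -/
noncomputable def IsChild (T : RTree V) (u v : V) : Prop :=
  T.Ancestor u v ∧ T.G.dist u v = 1

/-- A leaf is a vertex with no children. -/
def IsLeaf (T : RTree V) (u : V) : Prop := ∀ v, ¬ T.IsChild u v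

/-- The depth of a vertex is its graph distance from the root. -/
noncomputable def depth (T : RTree V) (v : V) : ℕ := T.G.dist T.root v

/-- `c` is the lowest common ancestor of `a` and `b`: a common ancestor of
maximal depth. -/
def IsLCA (T : RTree V) (c a b : V) : Prop :=
  T.Ancestor c a ∧ T.Ancestor c b ∧
    ∀ d, T.Ancestor d a → T.Ancestor d b → T.depth d ≤ T.depth c

/-- The lowest common ancestor of `a` and `b`. -/
noncomputable def lca (T : RTree V) (a b : V) : V :=
  haveI : Nonempty V := ⟨T.root⟩
  Classical.epsilon (fun c => T.IsLCA c a b)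

/-- The set of children of a vertex, as a finset. -/
noncomputable def childFinset (T : RTree V) (u : V) : Finset V :=
  Finset.univ.filter (fun v => T.IsChild u v)

/-- `g` is the generation function: `g u = 0` if `u` is a leaf, and
`g u = 1 + max of g v over the children v of u` otherwise. -/
def IsGenFun (T : RTree V) (g : V → ℕ) : Prop :=
  ∀ u, g u = if T.IsLeaf u then 0 else 1 + (T.childFinset u).sup g

/-- The generation function of the rooted tree. -/
noncomputable def gen (T : RTree V) : V → ℕ :=
  Classical.epsilon T.IsGenFun

/-- `v` is an enumeration of the leaves of `T`. -/
def IsLeafEnum (T : RTree V) {k : ℕ} (v : Fin k → V) : Prop :=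
  Function.Injective v ∧ ∀ u, T.IsLeaf u ↔ ∃ i, v i = u

/-- The LCAG matrix of `T` under the leaf enumeration `v`: its `(i,j)` entry is
`g (LCA (v i) (v j))`. -/
noncomputable def LCAG (T : RTree V) {k : ℕ} (v : Fin k → V) :
    Matrix (Fin k) (Fin k) ℕ :=
  Matrix.of fun i j => T.gen (T.lca (v i) (v j))

end RTree

namespace RTree

section aux

variable {V : Type*} [Fintype V]

lemma exists_step (T : RTree V) (u w : V) (h : u ≠ w) :
    ∃ x, T.G.Adj x w ∧ T.G.dist u x + 1 = T.G.dist u w := by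
  obtain ⟨p, hp⟩ := T.isTree.connected.exists_walk_length_eq_dist w u
  cases p with
  | nil => exact absurd rfl h
  | @cons _ x _ hadj q =>
    refine ⟨x, hadj.symm, ?_⟩
    have h1 := SimpleGraph.dist_le q
    have h2 : T.G.dist w u ≤ T.G.dist w x + T.G.dist x u := T.isTree.connected.dist_triangle
    have h3 := SimpleGraph.dist_eq_one_iff_adj.2 hadj
    rw [SimpleGraph.Walk.length_cons] at hp
    rw [SimpleGraph.dist_comm (u := u), SimpleGraph.dist_comm (u := u) (v := w)]
    omega

lemma tri (T : RTree V) (u v w : V) : T.G.dist u w ≤ T.G.dist u v + T.G.dist v w :=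
  T.isTree.connected.dist_triangle

lemma d0 (T : RTree V) {u v : V} (h : T.G.dist u v = 0) : u = v :=
  T.isTree.connected.dist_eq_zero_iff.1 h

lemma anc_refl (T : RTree V) (u : V) : T.Ancestor u u := by simp [Ancestor]

lemma anc_root (T : RTree V) (u : V) : T.Ancestor T.root u := by simp [Ancestor]

lemma anc_trans (T : RTree V) {u v w : V} (h1 : T.Ancestor u v) (h2 : T.Ancestor v w) :
    T.Ancestor u w := by
  unfold Ancestor at *
  have := T.tri u v w
  have := T.tri T.root u w
  omega

lemma anc_eq (T : RTree V) {u v : V} (h1 : T.Ancestor u v)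
    (h2 : T.G.dist T.root v ≤ T.G.dist T.root u) : u = v := by
  unfold Ancestor at *
  exact T.d0 (by omega)

lemma anc_antisymm (T : RTree V) {u v : V} (h1 : T.Ancestor u v) (h2 : T.Ancestor v u) :
    u = v := by
  apply T.anc_eq h1
  unfold Ancestor at *
  omega

lemma child_iff (T : RTree V) {u v : V} :
    T.IsChild u v ↔ T.G.Adj u v ∧ T.G.dist T.root v = T.G.dist T.root u + 1 := by
  unfold IsChild Ancestor
  rw [SimpleGraph.dist_eq_one_iff_adj]
  constructor
  · rintro ⟨h1, h2⟩
    rw [SimpleGraph.dist_eq_one_iff_adj.2 h2] at h1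
    exact ⟨h2, h1⟩
  · rintro ⟨h1, h2⟩
    rw [SimpleGraph.dist_eq_one_iff_adj.2 h1]
    exact ⟨h2, h1⟩

lemma parent_unique (T : RTree V) {p q v : V} (hp : T.IsChild p v) (hq : T.IsChild q v) :
    p = q := by
  rw [child_iff] at hp hq
  obtain ⟨P, hP⟩ := T.isTree.connected.exists_walk_length_eq_dist T.root p
  obtain ⟨Q, hQ⟩ := T.isTree.connected.exists_walk_length_eq_dist T.root q
  have h1 : (P.concat hp.1).IsPath := by
    apply SimpleGraph.Walk.isPath_of_length_eq_dist
    rw [SimpleGraph.Walk.length_concat]; omega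
  have h2 : (Q.concat hq.1).IsPath := by
    apply SimpleGraph.Walk.isPath_of_length_eq_dist
    rw [SimpleGraph.Walk.length_concat]; omega
  have h3 := congrArg Subtype.val
    (T.isTree.isAcyclic.path_unique ⟨_, h1⟩ ⟨_, h2⟩)
  have h4 := congrArg SimpleGraph.Walk.penultimate h3
  simpa using h4

lemma exists_parent (T : RTree V) {u w : V} (h : T.Ancestor u w) (hne : u ≠ w) :
    ∃ x, T.IsChild x w ∧ T.Ancestor u x := by
  obtain ⟨x, hx, hd⟩ := T.exists_step u w hne
  have h1 := T.tri T.root x w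
  have h2 := T.tri T.root u x
  have h3 := SimpleGraph.dist_eq_one_iff_adj.2 hx
  unfold Ancestor at *
  exact ⟨x, T.child_iff.2 ⟨hx, by omega⟩, by omega⟩

lemma exists_child (T : RTree V) {u w : V} (h : T.Ancestor u w) (hne : u ≠ w) :
    ∃ x, T.IsChild u x ∧ T.Ancestor x w := by
  obtain ⟨x, hx, hd⟩ := T.exists_step w u (Ne.symm hne)
  have h1 := T.tri T.root x w
  have h2 := T.tri T.root u x
  have h3 := SimpleGraph.dist_eq_one_iff_adj.2 hx.symm
  rw [SimpleGraph.dist_comm (u := w), SimpleGraph.dist_comm (u := w)] at hd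
  unfold Ancestor at *
  exact ⟨x, T.child_iff.2 ⟨hx.symm, by omega⟩, by omega⟩

lemma anc_total (T : RTree V) : ∀ (n : ℕ) {u v w : V}, T.G.dist T.root w = n →
    T.Ancestor u w → T.Ancestor v w → T.Ancestor u v ∨ T.Ancestor v u := by
  intro n
  induction n with
  | zero =>
    intro u v w hw hu hv
    have h1 : u = w := T.anc_eq hu (by omega)
    have h2 : v = w := T.anc_eq hv (by omega)
    subst h1; subst h2; exact Or.inl hu
  | succ n ih =>
    intro u v w hw hu hv
    by_cases h1 : u = w
    · subst h1; exact Or.inr hv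
    by_cases h2 : v = w
    · subst h2; exact Or.inl hu
    obtain ⟨x, hx, hux⟩ := T.exists_parent hu h1
    obtain ⟨y, hy, hvy⟩ := T.exists_parent hv h2
    have := T.parent_unique hx hy
    subst this
    have := (T.child_iff.1 hx).2
    exact ih (by omega) hux hvy

lemma anc_tot (T : RTree V) {u v w : V} (h1 : T.Ancestor u w) (h2 : T.Ancestor v w) :
    T.Ancestor u v ∨ T.Ancestor v u := T.anc_total _ rfl h1 h2

lemma child_ne (T : RTree V) {u v : V} (h : T.IsChild u v) : u ≠ v := by
  have := (T.child_iff.1 h).1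
  exact this.ne

lemma child_cover (T : RTree V) {u v : V} :
    T.IsChild u v ↔ T.Ancestor u v ∧ u ≠ v ∧
      ∀ w, T.Ancestor u w → T.Ancestor w v → w = u ∨ w = v := by
  constructor
  · intro h
    refine ⟨h.1, T.child_ne h, fun w h1 h2 => ?_⟩
    have h3 := (T.child_iff.1 h).2
    by_cases h4 : T.G.dist T.root w ≤ T.G.dist T.root u
    · exact Or.inl (T.anc_eq h1 h4).symm
    · exact Or.inr (T.anc_eq h2 (by omega))
  · rintro ⟨h1, h2, h3⟩
    obtain ⟨x, hx, hux⟩ := T.exists_parent h1 h2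
    rcases h3 x hux hx.1 with h | h
    · exact h ▸ hx
    · exact absurd h (T.child_ne hx)

lemma adj_iff (T : RTree V) {u v : V} : T.G.Adj u v ↔ T.IsChild u v ∨ T.IsChild v u := by
  rw [child_iff, child_iff]
  constructor
  · intro h
    rcases T.isTree.dist_eq_dist_add_one_of_adj T.root h with h1 | h1
    · exact Or.inr ⟨h.symm, h1⟩
    · exact Or.inl ⟨h, h1⟩
  · rintro (h | h)
    · exact h.1
    · exact h.1.symm

lemma isLCA_lca (T : RTree V) (a b : V) : T.IsLCA (T.lca a b) a b := by
  unfold lca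
  apply Classical.epsilon_spec (p := fun c => T.IsLCA c a b)
  obtain ⟨c, hc, hmax⟩ := Finset.exists_max_image
    (Finset.univ.filter fun c => T.Ancestor c a ∧ T.Ancestor c b) T.depth
    ⟨T.root, by simp [anc_root]⟩
  simp only [Finset.mem_filter, Finset.mem_univ, true_and] at hc hmax
  exact ⟨c, hc.1, hc.2, fun d h1 h2 => hmax d ⟨h1, h2⟩⟩

lemma IsLCA.anc {T : RTree V} {c a b d : V} (h : T.IsLCA c a b) (h1 : T.Ancestor d a)
    (h2 : T.Ancestor d b) : T.Ancestor d c := by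
  rcases T.anc_tot h1 h.1 with h3 | h3
  · exact h3
  · rw [T.anc_eq h3 (h.2.2 d h1 h2)]; exact T.anc_refl _

lemma IsLCA.unique {T : RTree V} {c d a b : V} (h : T.IsLCA c a b) (h' : T.IsLCA d a b) :
    c = d :=
  T.anc_antisymm (h'.anc h.1 h.2.1) (h.anc h'.1 h'.2.1)

lemma lca_self (T : RTree V) (a : V) : T.lca a a = a :=
  T.anc_antisymm (T.isLCA_lca a a).1 ((T.isLCA_lca a a).anc (T.anc_refl a) (T.anc_refl a))

lemma exists_genFun (T : RTree V) : ∃ g, T.IsGenFun g := by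
  refine ⟨fun u => (Finset.univ.filter fun v => T.Ancestor u v).sup (fun v => T.G.dist u v), ?_⟩
  intro u
  split_ifs with hu
  · rw [← Nat.le_zero]
    apply Finset.sup_le
    intro v hv
    simp only [Finset.mem_filter, Finset.mem_univ, true_and] at hv
    by_cases h : u = v
    · subst h; simp
    · obtain ⟨x, hx, _⟩ := T.exists_child hv h
      exact absurd hx (hu x)
  · apply le_antisymm
    · apply Finset.sup_le
      intro v hv
      simp only [Finset.mem_filter, Finset.mem_univ, true_and] at hv
      by_cases h : u = v
      · subst h; simp
      · obtain ⟨x, hx, hxv⟩ := T.exists_child hv h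
        have h1 := T.tri u x v
        have h2 := hx.2
        have h3 : T.G.dist x v ≤ (Finset.univ.filter fun v => T.Ancestor x v).sup
          (fun v => T.G.dist x v) :=
          Finset.le_sup (f := fun v => T.G.dist x v) (by simpa using hxv)
        have h4 := Finset.le_sup (s := T.childFinset u) (f := fun u =>
          (Finset.univ.filter fun v => T.Ancestor u v).sup (fun v => T.G.dist u v)) (b := x)
          (by simpa [childFinset] using hx)
        omega
    · unfold IsLeaf at hu
      push Not at hu
      obtain ⟨c0, hc0⟩ := hu
      obtain ⟨c, hc, hce⟩ := Finset.exists_mem_eq_sup (T.childFinset u)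
        ⟨c0, by simpa [childFinset] using hc0⟩ (fun u =>
          (Finset.univ.filter fun v => T.Ancestor u v).sup (fun v => T.G.dist u v))
      obtain ⟨v, hv, hve⟩ := Finset.exists_mem_eq_sup (Finset.univ.filter fun v => T.Ancestor c v)
        ⟨c, by simpa using T.anc_refl c⟩ (fun v => T.G.dist c v)
      rw [hce, hve]
      simp only [childFinset, Finset.mem_filter, Finset.mem_univ, true_and] at hc hv
      have h1 := T.anc_trans hc.1 hv
      refine le_trans ?_ (Finset.le_sup (f := fun v => T.G.dist u v) (b := v) (by simpa using h1))
      have h2 := hc.1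
      have h3 := hc.2
      unfold Ancestor at h1 h2 hv
      omega

lemma isGenFun_gen (T : RTree V) : T.IsGenFun T.gen := by
  unfold gen
  exact Classical.epsilon_spec T.exists_genFun

lemma IsGenFun.lt {T : RTree V} {g : V → ℕ} (hg : T.IsGenFun g) {u c : V}
    (h : T.IsChild u c) : g c < g u := by
  rw [hg u, if_neg (fun hl => hl c h)]
  have := Finset.le_sup (s := T.childFinset u) (f := g) (b := c) (by simpa [childFinset] using h)
  omega

lemma IsGenFun.unique {T : RTree V} {g h : V → ℕ} (hg : T.IsGenFun g) (hh : T.IsGenFun h) :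
    ∀ (n : ℕ) (u : V), g u = n → g u = h u := by
  intro n
  induction n using Nat.strong_induction_on with
  | _ n ih =>
    intro u hu
    rw [hg u, hh u]
    split_ifs with hl
    · rfl
    · congr 1
      apply Finset.sup_congr rfl
      intro c hc
      simp only [childFinset, Finset.mem_filter, Finset.mem_univ, true_and] at hc
      exact ih (g c) (hu ▸ hg.lt hc) c rfl

lemma gen_le (T : RTree V) : ∀ (n : ℕ) {u v : V}, T.G.dist u v = n → T.Ancestor u v →
    T.gen v ≤ T.gen u ∧ (u ≠ v → T.gen v < T.gen u) := by
  intro n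
  induction n with
  | zero => intro u v h _; rw [T.d0 h]; simp
  | succ n ih =>
    intro u v h ha
    have hne : u ≠ v := by rintro rfl; simp at h
    obtain ⟨x, hx, hxv⟩ := T.exists_child ha hne
    have h1 := T.isGenFun_gen.lt hx
    have h2 := hx.1
    have h3 := hx.2
    have h4 := (ih (u := x) (v := v) (by unfold Ancestor at *; omega) hxv).1
    exact ⟨by omega, fun _ => by omega⟩

lemma gen_mono (T : RTree V) {u v : V} (h : T.Ancestor u v) : T.gen v ≤ T.gen u :=
  (T.gen_le _ rfl h).1

lemma anc_of_gen_le (T : RTree V) {u v w : V} (h1 : T.Ancestor u w) (h2 : T.Ancestor v w)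
    (h : T.gen v ≤ T.gen u) : T.Ancestor u v := by
  rcases T.anc_tot h1 h2 with h3 | h3
  · exact h3
  · by_cases h4 : v = u
    · rw [h4]; exact T.anc_refl u
    · have := (T.gen_le _ rfl h3).2 h4
      omega

lemma exists_leaf (T : RTree V) (u : V) : ∃ l, T.IsLeaf l ∧ T.Ancestor u l := by
  obtain ⟨c, hc, hmax⟩ := Finset.exists_max_image
    (Finset.univ.filter fun c => T.Ancestor u c) T.depth ⟨u, by simp [anc_refl]⟩
  simp only [Finset.mem_filter, Finset.mem_univ, true_and] at hc hmax
  refine ⟨c, fun v hv => ?_, hc⟩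
  have := hmax v (T.anc_trans hc hv.1)
  have := (T.child_iff.1 hv).2
  unfold depth at *
  omega

lemma sib_eq (T : RTree V) {u c d w : V} (hc : T.IsChild u c) (hd : T.IsChild u d)
    (h1 : T.Ancestor c w) (h2 : T.Ancestor d w) : c = d := by
  have h3 := (T.child_iff.1 hc).2
  have h4 := (T.child_iff.1 hd).2
  rcases T.anc_tot h1 h2 with h | h
  · exact T.anc_eq h (by omega)
  · exact (T.anc_eq h (by omega)).symm

lemma exists_lca (T : RTree V) {k : ℕ} (a : Fin k → V)
    (hT2 : ∀ u, ¬ T.IsLeaf u → ∃ c₁ c₂, c₁ ≠ c₂ ∧ T.IsChild u c₁ ∧ T.IsChild u c₂)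
    (ha : T.IsLeafEnum a) (u : V) : ∃ p : Fin k × Fin k, T.lca (a p.1) (a p.2) = u := by
  by_cases hl : T.IsLeaf u
  · obtain ⟨i, rfl⟩ := (ha.2 u).1 hl
    exact ⟨(i, i), T.lca_self _⟩
  · obtain ⟨c, d, hne, hc, hd⟩ := hT2 u hl
    obtain ⟨l, hl, hcl⟩ := T.exists_leaf c
    obtain ⟨m, hm, hdm⟩ := T.exists_leaf d
    obtain ⟨i, rfl⟩ := (ha.2 l).1 hl
    obtain ⟨j, rfl⟩ := (ha.2 m).1 hm
    refine ⟨(i, j), ?_⟩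
    have h := T.isLCA_lca (a i) (a j)
    have h1 := h.anc (T.anc_trans hc.1 hcl) (T.anc_trans hd.1 hdm)
    by_contra h2
    obtain ⟨x, hx, hxl⟩ := T.exists_child h1 (Ne.symm h2)
    apply hne
    rw [← T.sib_eq hx hc (T.anc_trans hxl h.1) hcl]
    exact T.sib_eq hx hd (T.anc_trans hxl h.2.1) hdm

lemma anc_lca_iff (T : RTree V) {k : ℕ} (a : Fin k → V) (p q : Fin k × Fin k) :
    T.Ancestor (T.lca (a p.1) (a p.2)) (T.lca (a q.1) (a q.2)) ↔
      T.LCAG a q.1 p.1 ≤ T.LCAG a p.1 p.2 ∧ T.LCAG a q.1 q.2 ≤ T.LCAG a p.1 p.2 := by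
  simp only [LCAG, Matrix.of_apply]
  have hp := T.isLCA_lca (a p.1) (a p.2)
  have hq := T.isLCA_lca (a q.1) (a q.2)
  have hr := T.isLCA_lca (a q.1) (a p.1)
  constructor
  · intro h
    exact ⟨T.gen_mono (hr.anc (T.anc_trans h hq.1) hp.1), T.gen_mono h⟩
  · rintro ⟨h1, h2⟩
    have h3 := T.anc_of_gen_le hp.1 hr.2.1 h1
    exact T.anc_of_gen_le (T.anc_trans h3 hr.1) hq.1 h2

end aux

section two

variable {V W : Type*} [Fintype V] [Fintype W]

lemma dist_hom_le (T : RTree V) (S : RTree W) (f : T.G →g S.G) (u v : V) :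
    S.G.dist (f u) (f v) ≤ T.G.dist u v := by
  obtain ⟨p, hp⟩ := T.isTree.connected.exists_walk_length_eq_dist u v
  rw [← hp, ← SimpleGraph.Walk.length_map f p]
  exact SimpleGraph.dist_le _

lemma dist_iso (T : RTree V) (S : RTree W) (f : T.G ≃g S.G) (u v : V) :
    S.G.dist (f u) (f v) = T.G.dist u v := by
  apply le_antisymm
  · exact T.dist_hom_le S f.toHom u v
  · have := S.dist_hom_le T f.symm.toHom (f u) (f v)
    simpa using this

lemma lcag_of_iso (T : RTree V) (S : RTree W) {k : ℕ} (a : Fin k → V) (b : Fin k → W)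
    (f : T.G ≃g S.G) (hr : f T.root = S.root) (hf : ∀ i, f (a i) = b i) :
    T.LCAG a = S.LCAG b := by
  have hanc : ∀ u v, S.Ancestor (f u) (f v) ↔ T.Ancestor u v := by
    intro u v
    unfold Ancestor
    rw [← hr, T.dist_iso S, T.dist_iso S, T.dist_iso S]
  have hch : ∀ u v, S.IsChild (f u) (f v) ↔ T.IsChild u v := by
    intro u v
    unfold IsChild
    rw [hanc, T.dist_iso S]
  have hleaf : ∀ u, S.IsLeaf (f u) ↔ T.IsLeaf u := by
    intro u
    unfold IsLeaf
    rw [← f.toEquiv.forall_congr_right]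
    exact forall_congr' fun v => not_congr (hch u v)
  have hdep : ∀ u, S.depth (f u) = T.depth u := by
    intro u
    unfold depth
    rw [← hr, T.dist_iso S]
  have hgen : T.IsGenFun (fun u => S.gen (f u)) := by
    intro u
    simp only
    rw [S.isGenFun_gen (f u)]
    simp only [hleaf]
    split_ifs
    · rfl
    · congr 1
      have : S.childFinset (f u) = (T.childFinset u).map f.toEquiv.toEmbedding := by
        ext w
        obtain ⟨v, rfl⟩ := f.surjective w
        simp [childFinset, hch]
        erw [f.toEquiv.symm_apply_apply]
      rw [this, Finset.sup_map]
      rfl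
  have hlca : ∀ u v, S.lca (f u) (f v) = f (T.lca u v) := by
    intro u v
    apply (S.isLCA_lca (f u) (f v)).unique
    obtain ⟨h1, h2, h3⟩ := T.isLCA_lca u v
    refine ⟨(hanc _ _).2 h1, (hanc _ _).2 h2, fun d => ?_⟩
    obtain ⟨d, rfl⟩ := f.surjective d
    rw [hanc, hanc, hdep, hdep]
    exact h3 d
  ext i j
  simp only [LCAG, Matrix.of_apply]
  rw [← hf, ← hf, hlca]
  exact T.isGenFun_gen.unique hgen _ _ rfl

lemma iso_of_lcag (T : RTree V) (S : RTree W) {k : ℕ} (a : Fin k → V) (b : Fin k → W)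
    (hT2 : ∀ u, ¬ T.IsLeaf u → ∃ c₁ c₂, c₁ ≠ c₂ ∧ T.IsChild u c₁ ∧ T.IsChild u c₂)
    (hS2 : ∀ u, ¬ S.IsLeaf u → ∃ c₁ c₂, c₁ ≠ c₂ ∧ S.IsChild u c₁ ∧ S.IsChild u c₂)
    (ha : T.IsLeafEnum a) (hb : S.IsLeafEnum b) (h : T.LCAG a = S.LCAG b) :
    ∃ f : T.G ≃g S.G, f T.root = S.root ∧ ∀ i, f (a i) = b i := by
  choose P hP using T.exists_lca a hT2 ha
  choose Q hQ using S.exists_lca b hS2 hb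
  have key : ∀ p q : Fin k × Fin k,
      S.Ancestor (S.lca (b p.1) (b p.2)) (S.lca (b q.1) (b q.2)) ↔
      T.Ancestor (T.lca (a p.1) (a p.2)) (T.lca (a q.1) (a q.2)) := by
    intro p q
    rw [anc_lca_iff, anc_lca_iff, h]
  have key2 : ∀ p q : Fin k × Fin k,
      S.lca (b p.1) (b p.2) = S.lca (b q.1) (b q.2) ↔
      T.lca (a p.1) (a p.2) = T.lca (a q.1) (a q.2) := by
    intro p q
    constructor
    · intro e
      apply T.anc_antisymm
      · rw [← key, e]; exact S.anc_refl _
      · rw [← key, e]; exact S.anc_refl _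
    · intro e
      apply S.anc_antisymm
      · rw [key, e]; exact T.anc_refl _
      · rw [key, e]; exact T.anc_refl _
  let F : V ≃ W :=
    { toFun := fun u => S.lca (b (P u).1) (b (P u).2)
      invFun := fun w => T.lca (a (Q w).1) (a (Q w).2)
      left_inv := fun u => by
        refine Eq.trans ?_ (hP u)
        rw [← key2, hQ]
      right_inv := fun w => by
        refine Eq.trans ?_ (hQ w)
        rw [key2, hP] }
  have hF : ∀ p : Fin k × Fin k, F (T.lca (a p.1) (a p.2)) = S.lca (b p.1) (b p.2) := by
    intro p
    change S.lca _ _ = _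
    rw [key2, hP]
  have hanc : ∀ u v, S.Ancestor (F u) (F v) ↔ T.Ancestor u v := by
    intro u v
    change S.Ancestor (S.lca _ _) (S.lca _ _) ↔ _
    rw [key, hP, hP]
  have hch : ∀ u v, S.IsChild (F u) (F v) ↔ T.IsChild u v := by
    intro u v
    rw [child_cover, child_cover, hanc, ← F.forall_congr_right]
    simp only [hanc, ne_eq, F.apply_eq_iff_eq]
  refine ⟨⟨F, ?_⟩, ?_, ?_⟩
  · intro u v
    rw [adj_iff, adj_iff, hch, hch]
  · change F T.root = S.root
    apply S.anc_antisymm _ (S.anc_root _)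
    obtain ⟨v, hv⟩ := F.surjective S.root
    rw [← hv, hanc]
    exact T.anc_root v
  · intro i
    change F (a i) = b i
    have := hF (i, i)
    simpa only [lca_self] using this

end two

end RTree

/-- For rooted trees in which every internal vertex has at least two
children, with leaf enumerations `a` and `b`, there is a rooted-tree isomorphism
matching the enumerations if and only if the LCAG matrices are equal: the LCAG matrix
is a complete invariant up to rooted-tree isomorphism respecting the leaf
enumeration. -/
theorem iso_iff_lcag_eq {V W : Type*} [Fintype V] [Fintype W]
    (T : RTree V) (S : RTree W) {k : ℕ} (a : Fin k → V) (b : Fin k → W)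
    (hT2 : ∀ u, ¬ T.IsLeaf u → ∃ c₁ c₂, c₁ ≠ c₂ ∧ T.IsChild u c₁ ∧ T.IsChild u c₂)
    (hS2 : ∀ u, ¬ S.IsLeaf u → ∃ c₁ c₂, c₁ ≠ c₂ ∧ S.IsChild u c₁ ∧ S.IsChild u c₂)
    (ha : T.IsLeafEnum a) (hb : S.IsLeafEnum b) :
    (∃ f : T.G ≃g S.G, f T.root = S.root ∧ ∀ i, f (a i) = b i) ↔
      T.LCAG a = S.LCAG b := by
  constructor
  · rintro ⟨f, hr, hf⟩
    exact T.lcag_of_iso S a b f hr hf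
  · exact T.iso_of_lcag S a b hT2 hS2 ha hb
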